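/- Opposite-edge quadratic covariation identity for SO(N) (deterministic form of the martingale bracket identity between an edge variable and its reversal underlying the SO(N) master loop equation): for every N ≥ 2, every Q ∈ SO(N), every orthonormal basis (v_α) of so(N) with respect to ⟨X, Y⟩ = Tr(X Yᵀ), and all real N×N matrices P and R, one has Σ_α Tr(v_α Q P Qᵀ v_α R) = (1/2) Tr(Q Pᵀ Qᵀ R) − (1/2) Tr(P) Tr(R). -/

import Mathlib

open Matrix

section OrthonormalSkew

variable {n ι : Type*} [Fintype n] [DecidableEq n] [Fintype ι] [DecidableEq ι]
  {v : ι → Matrix n n ℝ}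

/-- Expansion of an element of the span of a trace-orthonormal family. -/
lemma sum_trace_smul_eq_of_mem_span
    (horth : ∀ α β, Matrix.trace (v α * (v β)ᵀ) = if α = β then 1 else 0)
    {X : Matrix n n ℝ} (hX : X ∈ Submodule.span ℝ (Set.range v)) :
    ∑ α, Matrix.trace (X * (v α)ᵀ) • v α = X := by
  induction hX using Submodule.span_induction with
  | mem x hx =>
    obtain ⟨β, rfl⟩ := hx
    simp [horth]
  | zero => simp
  | add x y _ _ hx hy => simp [add_mul, add_smul, Finset.sum_add_distrib, hx, hy]
  | smul a x _ hx => simp [mul_smul, ← Finset.smul_sum, hx]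

/-- Completeness relation for an orthonormal basis of the skew-symmetric matrices. -/
lemma sum_apply_mul_apply_of_orthonormal_skew
    (hskew : ∀ α, (v α)ᵀ = -(v α))
    (horth : ∀ α β, Matrix.trace (v α * (v β)ᵀ) = if α = β then 1 else 0)
    (hspan : ∀ X : Matrix n n ℝ, Xᵀ = -X → X ∈ Submodule.span ℝ (Set.range v))
    (i j k l : n) :
    ∑ α, v α i j * v α k l =
      (1 / 2) * ((if i = k ∧ j = l then 1 else 0) - if j = k ∧ i = l then 1 else 0) := by
  have hX : (single i j (1 : ℝ) - single j i 1)ᵀ = -(single i j (1 : ℝ) - single j i 1) := by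
    simp
  have htr (α : ι) :
      Matrix.trace ((single i j (1 : ℝ) - single j i 1) * (v α)ᵀ) = 2 * v α i j := by
    have hji : v α j i = -v α i j := congrFun (congrFun (hskew α) i) j
    simp only [sub_mul, trace_sub, trace_single_mul, transpose_apply, hji]
    simp
    ring
  have h := congrFun (congrFun (sum_trace_smul_eq_of_mem_span horth (hspan _ hX)) k) l
  simp only [htr, Matrix.sum_apply, Matrix.smul_apply, smul_eq_mul, mul_assoc, ← Finset.mul_sum, Matrix.sub_apply,
    single_apply] at h
  linarith

/-- Sandwiching a matrix between an orthonormal basis of the skew-symmetric matrices. -/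
lemma sum_mul_mul_of_orthonormal_skew
    (hskew : ∀ α, (v α)ᵀ = -(v α))
    (horth : ∀ α β, Matrix.trace (v α * (v β)ᵀ) = if α = β then 1 else 0)
    (hspan : ∀ X : Matrix n n ℝ, Xᵀ = -X → X ∈ Submodule.span ℝ (Set.range v))
    (A : Matrix n n ℝ) :
    ∑ α, v α * A * v α = (1 / 2 : ℝ) • (Aᵀ - Matrix.trace A • (1 : Matrix n n ℝ)) := by
  ext i l
  calc (∑ α, v α * A * v α) i l = ∑ k, ∑ j, A j k * ∑ α, v α i j * v α k l := by
        simp only [Matrix.sum_apply, mul_apply, Finset.sum_mul, Finset.mul_sum]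
        rw [Finset.sum_comm]
        refine Finset.sum_congr rfl fun k _ => ?_
        rw [Finset.sum_comm]
        exact Finset.sum_congr rfl fun j _ => Finset.sum_congr rfl fun α _ => by ring
    _ = ∑ k, ∑ j, ((1 / 2) * (if i = k then if j = l then A j k else 0 else 0)
          - (1 / 2) * (if j = k then if i = l then A j k else 0 else 0)) := by
        refine Finset.sum_congr rfl fun k _ => Finset.sum_congr rfl fun j _ => ?_
        rw [sum_apply_mul_apply_of_orthonormal_skew hskew horth hspan]
        simp only [ite_and]
        split_ifs <;> ring
    _ = _ := by
        simp only [Finset.sum_sub_distrib, ← Finset.mul_sum, Matrix.smul_apply, Matrix.sub_apply,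
          transpose_apply, one_apply, smul_eq_mul, Matrix.trace, diag_apply]
        by_cases hil : i = l <;> simp [hil, Finset.sum_ite_irrel] <;> ring

end OrthonormalSkew

/-- **Opposite-edge quadratic covariation identity for `SO(N)`** (deterministic form of the
martingale bracket identity between an edge variable and its reversal underlying the
`SO(N)` master loop equation): for every `N ≥ 2`, every `Q ∈ SO(N)`, every orthonormal
basis `(v_α)` of the skew-symmetric real `N × N` matrices with respect to
`⟨X, Y⟩ = Tr (X Yᵀ)` (orthonormality together with spanning), and all real `N × N`
matrices `P`, `R`, one has
`Σ_α Tr(v_α Q P Qᵀ v_α R) = (1/2) Tr(Q Pᵀ Qᵀ R) − (1/2) Tr(P) Tr(R)`. -/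
theorem so_opposite_edge_covariation (N : ℕ) (hN : 2 ≤ N)
    (Q : Matrix (Fin N) (Fin N) ℝ) (hQorth : Qᵀ * Q = 1) (hQdet : Q.det = 1)
    (v : Fin (N * (N - 1) / 2) → Matrix (Fin N) (Fin N) ℝ)
    (hskew : ∀ α, (v α)ᵀ = -(v α))
    (horth : ∀ α β, Matrix.trace (v α * (v β)ᵀ) = if α = β then 1 else 0)
    (hspan : ∀ X : Matrix (Fin N) (Fin N) ℝ, Xᵀ = -X →
      X ∈ Submodule.span ℝ (Set.range v))
    (P R : Matrix (Fin N) (Fin N) ℝ) :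
    ∑ α, Matrix.trace (v α * Q * P * Qᵀ * (v α) * R)
      = (1 / 2) * Matrix.trace (Q * Pᵀ * Qᵀ * R)
        - (1 / 2) * Matrix.trace P * Matrix.trace R := by
  have hQ : ∑ α, Matrix.trace (v α * Q * P * Qᵀ * (v α) * R)
      = Matrix.trace ((∑ α, v α * (Q * P * Qᵀ) * v α) * R) := by
    simp only [Finset.sum_mul, trace_sum, mul_assoc]
  have hP : Matrix.trace (Q * P * Qᵀ) = Matrix.trace P := by
    rw [trace_mul_comm, ← mul_assoc, hQorth, one_mul]
  rw [hQ, sum_mul_mul_of_orthonormal_skew hskew horth hspan, hP]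
  simp only [transpose_mul, transpose_transpose, smul_mul_assoc, sub_mul, one_mul, trace_smul,
    trace_sub, smul_eq_mul, mul_assoc]
  ring
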